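/- In the oscillator algebra 𝔤ₙ(λ), the unit vector ξ is not totally geodesic: there exist X, Y ∈ 𝔤ₙ(λ) with Hess_ξ(X,Y) + A_ξ Hm_ξ(X,Y) − g(A_ξ X, A_ξ Y) ξ ≠ 0 (for instance X = e₁, Y = ξ, for which this expression equals −(3/32) e₁). -/

import Mathlib

open scoped RealInnerProductSpace
open Finset

noncomputable section

/-- The underlying inner product space of the oscillator algebra `𝔤ₙ(λ)`:
a `(2n+2)`-dimensional real inner product space. -/
abbrev Osc (n : ℕ) := EuclideanSpace ℝ (Fin (2*n+2))

/-- The basis vectors `e₁, …, eₙ`. -/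
def oe (n : ℕ) (i : Fin n) : Osc n :=
  EuclideanSpace.single ⟨i.1, by have := i.2; omega⟩ 1

/-- The basis vectors `e_{n+1}, …, e_{2n}`. -/
def oE (n : ℕ) (i : Fin n) : Osc n :=
  EuclideanSpace.single ⟨n + i.1, by have := i.2; omega⟩ 1

/-- The basis vector `ξ`. -/
def oXi (n : ℕ) : Osc n := EuclideanSpace.single ⟨2*n, by omega⟩ 1

/-- The basis vector `ζ`. -/
def oZeta (n : ℕ) : Osc n := EuclideanSpace.single ⟨2*n+1, by omega⟩ 1

/-- `br` is the Lie bracket of the oscillator algebra `𝔤ₙ(λ)`: the bilinear map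
determined by `[eᵢ, e_{n+j}] = δᵢⱼ ξ`, `[ζ, eⱼ] = λⱼ e_{n+j}`, `[ζ, e_{n+j}] = −λⱼ eⱼ`,
all other brackets of basis vectors being zero. -/
structure IsOscBracket (n : ℕ) (lam : Fin n → ℝ)
    (br : Osc n →ₗ[ℝ] Osc n →ₗ[ℝ] Osc n) : Prop where
  anti : ∀ X Y : Osc n, br X Y = - br Y X
  ee : ∀ i j : Fin n, br (oe n i) (oe n j) = 0
  eE : ∀ i j : Fin n, br (oe n i) (oE n j) = if i = j then oXi n else 0
  EE : ∀ i j : Fin n, br (oE n i) (oE n j) = 0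
  exi : ∀ i : Fin n, br (oe n i) (oXi n) = 0
  Exi : ∀ i : Fin n, br (oE n i) (oXi n) = 0
  zee : ∀ j : Fin n, br (oZeta n) (oe n j) = lam j • oE n j
  zeE : ∀ j : Fin n, br (oZeta n) (oE n j) = - (lam j • oe n j)
  xize : br (oXi n) (oZeta n) = 0

/-- `nab` is the Levi-Civita connection of the left-invariant metric (evaluated on
left-invariant fields): the bilinear map determined by the Koszul formula
`2 g(∇_X Y, Z) = g([X,Y], Z) − g([Y,Z], X) + g([Z,X], Y)`. -/
def IsLeviCivita (n : ℕ) (br nab : Osc n →ₗ[ℝ] Osc n →ₗ[ℝ] Osc n) : Prop :=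
  ∀ X Y Z : Osc n,
    2 * ⟪nab X Y, Z⟫ = ⟪br X Y, Z⟫ - ⟪br Y Z, X⟫ + ⟪br Z X, Y⟫

/-- The Nomizu operator `A_V X = −∇_X V`. -/
def nomizu {n : ℕ} (nab : Osc n →ₗ[ℝ] Osc n →ₗ[ℝ] Osc n) (V X : Osc n) : Osc n :=
  -(nab X V)

/-- The covariant derivative of the Nomizu operator:
`(∇_X A_V) Y = ∇_X (A_V Y) − A_V (∇_X Y)`. -/
def covNomizu {n : ℕ} (nab : Osc n →ₗ[ℝ] Osc n →ₗ[ℝ] Osc n) (V X Y : Osc n) : Osc n :=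
  nab X (nomizu nab V Y) - nomizu nab V (nab X Y)

/-- The curvature tensor `R(X,Y)Z = ∇_X ∇_Y Z − ∇_Y ∇_X Z − ∇_{[X,Y]} Z`. -/
def curvR {n : ℕ} (br nab : Osc n →ₗ[ℝ] Osc n →ₗ[ℝ] Osc n) (X Y Z : Osc n) : Osc n :=
  nab X (nab Y Z) - nab Y (nab X Z) - nab (br X Y) Z

/-- A unit vector `V ∈ 𝔤ₙ(λ)` is a *minimal* unit vector field if there is an orthonormal
basis `u₁, …, u_{2n+2}` of eigenvectors of `A_Vᵀ A_V` (the eigenvector condition being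
expressed as `g(A_V W, A_V uᵢ) = σᵢ² g(W, uᵢ)` for all `W`) with eigenvalues `σᵢ²` such that
`Σᵢ ((∇_{uᵢ} A_V)uᵢ + A_V R(V, A_V uᵢ)uᵢ)/(1 + σᵢ²) = (Σᵢ σᵢ²/(1 + σᵢ²)) V`. -/
def IsMinimal {n : ℕ} (br nab : Osc n →ₗ[ℝ] Osc n →ₗ[ℝ] Osc n) (V : Osc n) : Prop :=
  ∃ (u : Fin (2*n+2) → Osc n) (σ : Fin (2*n+2) → ℝ),
    (∀ i j, ⟪u i, u j⟫ = if i = j then 1 else 0) ∧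
    (∀ i, ∀ W : Osc n,
      ⟪nomizu nab V W, nomizu nab V (u i)⟫ = (σ i)^2 * ⟪W, u i⟫) ∧
    (∑ i, (1 + (σ i)^2)⁻¹ •
        (covNomizu nab V (u i) (u i) +
          nomizu nab V (curvR br nab V (nomizu nab V (u i)) (u i))))
      = (∑ i, (σ i)^2 / (1 + (σ i)^2)) • V

/-- The operator `φ` with `φ eᵢ = e_{n+i}`, `φ e_{n+i} = −eᵢ`, `φ ξ = φ ζ = 0`. -/
structure IsPhi (n : ℕ) (phi : Osc n →ₗ[ℝ] Osc n) : Prop where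
  he : ∀ i : Fin n, phi (oe n i) = oE n i
  hE : ∀ i : Fin n, phi (oE n i) = - oe n i
  hxi : phi (oXi n) = 0
  hzeta : phi (oZeta n) = 0

/-- The operator `E_λ` with `E_λ eᵢ = λᵢ eᵢ`, `E_λ e_{n+i} = λᵢ e_{n+i}`, `E_λ ξ = E_λ ζ = 0`. -/
structure IsElam (n : ℕ) (lam : Fin n → ℝ) (El : Osc n →ₗ[ℝ] Osc n) : Prop where
  he : ∀ i : Fin n, El (oe n i) = lam i • oe n i
  hE : ∀ i : Fin n, El (oE n i) = lam i • oE n i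
  hxi : El (oXi n) = 0
  hzeta : El (oZeta n) = 0
/-- Linear maps on the oscillator algebra that agree on the standard basis are equal. -/
theorem osc_linearMap_ext {n : ℕ} {M : Type*} [AddCommGroup M] [Module ℝ M]
    {f g : Osc n →ₗ[ℝ] M} (he : ∀ i, f (oe n i) = g (oe n i))
    (hE : ∀ i, f (oE n i) = g (oE n i)) (hxi : f (oXi n) = g (oXi n))
    (hzeta : f (oZeta n) = g (oZeta n)) : f = g := by
  refine (EuclideanSpace.basisFun (Fin (2*n+2)) ℝ).toBasis.ext fun k => ?_
  obtain ⟨k, hk⟩ := k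
  simp only [OrthonormalBasis.coe_toBasis, EuclideanSpace.basisFun_apply]
  rcases lt_or_ge k n with h | h
  · exact he ⟨k, h⟩
  rcases lt_or_ge k (2*n) with h' | h'
  · obtain ⟨j, rfl⟩ := Nat.exists_eq_add_of_le h
    exact hE ⟨j, by omega⟩
  obtain rfl | rfl : k = 2*n ∨ k = 2*n+1 := by omega
  · exact hxi
  · exact hzeta

theorem inner_oe_oe {n : ℕ} (i j : Fin n) :
    ⟪oe n i, oe n j⟫ = if i = j then (1 : ℝ) else 0 := by
  simp [oe, EuclideanSpace.inner_single_left, Fin.ext_iff]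

theorem inner_oE_oE {n : ℕ} (i j : Fin n) :
    ⟪oE n i, oE n j⟫ = if i = j then (1 : ℝ) else 0 := by
  simp [oE, EuclideanSpace.inner_single_left, Fin.ext_iff]

theorem inner_oe_oE {n : ℕ} (i j : Fin n) : ⟪oe n i, oE n j⟫ = (0 : ℝ) := by
  have : i.1 ≠ n + j.1 := by omega
  simp [oe, oE, EuclideanSpace.inner_single_left, this]

theorem inner_oe_oXi {n : ℕ} (i : Fin n) : ⟪oe n i, oXi n⟫ = (0 : ℝ) := by
  have : i.1 ≠ 2*n := by omega
  simp [oe, oXi, EuclideanSpace.inner_single_left, this]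

theorem inner_oE_oXi {n : ℕ} (i : Fin n) : ⟪oE n i, oXi n⟫ = (0 : ℝ) := by
  have : n + i.1 ≠ 2*n := by omega
  simp [oE, oXi, EuclideanSpace.inner_single_left, this]

theorem inner_oe_oZeta {n : ℕ} (i : Fin n) : ⟪oe n i, oZeta n⟫ = (0 : ℝ) := by
  have : i.1 ≠ 2*n+1 := by omega
  simp [oe, oZeta, EuclideanSpace.inner_single_left, this]

theorem inner_oE_oZeta {n : ℕ} (i : Fin n) : ⟪oE n i, oZeta n⟫ = (0 : ℝ) := by
  have : n + i.1 ≠ 2*n+1 := by omega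
  simp [oE, oZeta, EuclideanSpace.inner_single_left, this]

theorem norm_oe {n : ℕ} (i : Fin n) : ‖oe n i‖ = 1 := by simp [oe]

theorem norm_oE {n : ℕ} (i : Fin n) : ‖oE n i‖ = 1 := by simp [oE]

theorem norm_oXi {n : ℕ} : ‖oXi n‖ = 1 := by simp [oXi]

namespace IsOscBracket

variable {n : ℕ} {lam : Fin n → ℝ} {br nab : Osc n →ₗ[ℝ] Osc n →ₗ[ℝ] Osc n}

/-- `ξ` is central. -/
theorem xi_left (hbr : IsOscBracket n lam br) : br (oXi n) = 0 := by
  refine osc_linearMap_ext (fun i => ?_) (fun i => ?_) ?_ ?_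
  · simp [hbr.anti (oXi n), hbr.exi]
  · simp [hbr.anti (oXi n), hbr.Exi]
  · have : IsAddTorsionFree (Osc n) := .of_isTorsionFree ℝ _
    exact self_eq_neg.mp (hbr.anti (oXi n) (oXi n))
  · exact hbr.xize

theorem inner_oe_bracket_xi (hbr : IsOscBracket n lam br) (i : Fin n) (Z : Osc n) :
    ⟪oXi n, br (oe n i) Z⟫ = ⟪oE n i, Z⟫ := by
  have h : (innerₛₗ ℝ (oXi n)).comp (br (oe n i)) = innerₛₗ ℝ (oE n i) := by
    refine osc_linearMap_ext (fun j => ?_) (fun j => ?_) ?_ ?_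
    · simp [hbr.ee, real_inner_comm (oe n j), inner_oe_oE]
    · by_cases hij : i = j <;> simp [hbr.eE, inner_oE_oE, norm_oE, norm_oXi, hij]
    · simp [hbr.exi, inner_oE_oXi]
    · simp [hbr.anti _ (oZeta n), hbr.zee, inner_smul_right, real_inner_comm (oE n i) (oXi n),
        inner_oE_oXi, inner_oE_oZeta]
  exact LinearMap.congr_fun h Z

theorem inner_oE_bracket_xi (hbr : IsOscBracket n lam br) (i : Fin n) (Z : Osc n) :
    ⟪oXi n, br (oE n i) Z⟫ = -⟪oe n i, Z⟫ := by
  have h : (innerₛₗ ℝ (oXi n)).comp (br (oE n i)) = -innerₛₗ ℝ (oe n i) := by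
    refine osc_linearMap_ext (fun j => ?_) (fun j => ?_) ?_ ?_
    · rcases eq_or_ne i j with rfl | hij
      · simp [hbr.anti (oE n i), hbr.eE, norm_oe, norm_oXi]
      · simp [hbr.anti (oE n i), hbr.eE, inner_oe_oe, hij, hij.symm]
    · simp [hbr.EE, inner_oe_oE]
    · simp [hbr.Exi, inner_oe_oXi]
    · simp [hbr.anti _ (oZeta n), hbr.zeE, inner_smul_right, real_inner_comm (oe n i) (oXi n),
        inner_oe_oXi, inner_oe_oZeta]
  exact LinearMap.congr_fun h Z

theorem two_mul_inner_nab_xi (hbr : IsOscBracket n lam br) (hlc : IsLeviCivita n br nab)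
    (X Z : Osc n) : 2 * ⟪nab X (oXi n), Z⟫ = -⟪oXi n, br X Z⟫ := by
  rw [hlc, hbr.anti X (oXi n), hbr.xi_left, hbr.anti Z X]
  simp [real_inner_comm]

/-- As `ξ` is central and `∇` is torsion-free, `∇_ξ X = ∇_X ξ`. -/
theorem nab_xi_left (hbr : IsOscBracket n lam br) (hlc : IsLeviCivita n br nab) (X : Osc n) :
    nab (oXi n) X = nab X (oXi n) := by
  refine ext_inner_right ℝ fun Z => ?_
  have h := hlc (oXi n) X Z
  rw [hbr.anti Z (oXi n), hbr.xi_left] at h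
  have h' := hbr.two_mul_inner_nab_xi hlc X Z
  rw [real_inner_comm (br X Z)] at h'
  simp only [LinearMap.zero_apply, inner_zero_left, neg_zero] at h
  linarith

theorem nab_oe_xi (hbr : IsOscBracket n lam br) (hlc : IsLeviCivita n br nab) (i : Fin n) :
    nab (oe n i) (oXi n) = -((1/2 : ℝ) • oE n i) := by
  refine ext_inner_right ℝ fun Z => ?_
  have h := hbr.two_mul_inner_nab_xi hlc (oe n i) Z
  rw [hbr.inner_oe_bracket_xi] at h
  rw [inner_neg_left, real_inner_smul_left]
  linarith

theorem nab_oE_xi (hbr : IsOscBracket n lam br) (hlc : IsLeviCivita n br nab) (i : Fin n) :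
    nab (oE n i) (oXi n) = (1/2 : ℝ) • oe n i := by
  refine ext_inner_right ℝ fun Z => ?_
  have h := hbr.two_mul_inner_nab_xi hlc (oE n i) Z
  rw [hbr.inner_oE_bracket_xi] at h
  rw [real_inner_smul_left]
  linarith

theorem nab_xi_xi (hbr : IsOscBracket n lam br) (hlc : IsLeviCivita n br nab) :
    nab (oXi n) (oXi n) = 0 := by
  refine ext_inner_right ℝ fun Z => ?_
  have h := hbr.two_mul_inner_nab_xi hlc (oXi n) Z
  rw [hbr.xi_left] at h
  simpa using h

end IsOscBracket

/-- The unit vector field `ξ` on the oscillator group is not totally geodesic: for some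
`X, Y` one has `Hess_ξ(X,Y) + A_ξ Hm_ξ(X,Y) − g(A_ξ X, A_ξ Y) ξ ≠ 0`. -/
theorem xi_not_totally_geodesic (n : ℕ) (hn : 1 ≤ n) (lam : Fin n → ℝ)
    (br nab : Osc n →ₗ[ℝ] Osc n →ₗ[ℝ] Osc n)
    (hbr : IsOscBracket n lam br) (hlc : IsLeviCivita n br nab) :
    ∃ X Y : Osc n,
      ((1/2) : ℝ) • (covNomizu nab (oXi n) X Y + covNomizu nab (oXi n) Y X)
      + nomizu nab (oXi n)
          (((1/2) : ℝ) • (curvR br nab (oXi n) (nomizu nab (oXi n) X) Y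
            + curvR br nab (oXi n) (nomizu nab (oXi n) Y) X))
      - ⟪nomizu nab (oXi n) X, nomizu nab (oXi n) Y⟫ • oXi n ≠ 0 := by
  let i : Fin n := ⟨0, hn⟩
  refine ⟨oe n i, oXi n, fun h => ?_⟩
  have key : (-(3/32) : ℝ) • oe n i = 0 := by
    rw [← h]
    simp only [covNomizu, curvR, nomizu, hbr.xi_left, hbr.nab_xi_left hlc, hbr.nab_oe_xi hlc,
      hbr.nab_oE_xi hlc, hbr.nab_xi_xi hlc, map_neg, map_smul, map_add, map_sub, map_zero,
      LinearMap.neg_apply, LinearMap.smul_apply, LinearMap.add_apply, LinearMap.sub_apply,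
      LinearMap.zero_apply, neg_zero, inner_zero_right, zero_smul]
    module
  have hne : oe n i ≠ 0 := fun h0 => by simpa [h0] using norm_oe i
  exact smul_ne_zero (by norm_num) hne key
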